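/- arXiv:0807.2871 — 2 statements merged into one kernel-verified Lean document; each statement's English description precedes it below -/
import Mathlib

section
/- Let G be a subgroup of Homeo₊(S¹) with no non-abelian free subgroup. Then the family of fixed point sets {Fix(g) : g ∈ G, Fix(g) ≠ ∅} has the finite intersection property, and consequently, by compactness of S¹, the subgroup G₀ of elements with fixed points has a common (global) fixed point: ⋂_{g ∈ G₀} Fix(g) ≠ ∅. -/
/-- The circle `S¹ = ℝ/ℤ`. -/
abbrev S1 := AddCircle (1 : ℝ)

/-- `F : ℝ → ℝ` is a lift of `f` through the covering `ℝ → ℝ/ℤ`, witnessing that `f`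
is an orientation-preserving homeomorphism of the circle. -/
def IsLiftOf (f : Equiv.Perm S1) (F : ℝ → ℝ) : Prop :=
  StrictMono F ∧ Continuous F ∧ (∀ x : ℝ, F (x + 1) = F x + 1) ∧
    ∀ x : ℝ, f ((x : ℝ) : S1) = ((F x : ℝ) : S1)

/-- `f` is an orientation-preserving homeomorphism of the circle. -/
def IsPosHomeo (f : Equiv.Perm S1) : Prop := ∃ F, IsLiftOf f F

/-- `ρ` is the translation number of the lift `F`. -/
def HasRotLim (F : ℝ → ℝ) (ρ : ℝ) : Prop :=
  Filter.Tendsto (fun n : ℕ => F^[n] 0 / n) Filter.atTop (nhds ρ)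

/-- `G` contains a non-abelian free subgroup (one isomorphic to the free group of rank 2). -/
def HasFreeSubgroup (G : Subgroup (Equiv.Perm S1)) : Prop :=
  ∃ φ : FreeGroup (Fin 2) →* Equiv.Perm S1, Function.Injective φ ∧ ∀ w, φ w ∈ G

open Filter Topology Pointwise

/-- `F` is an increasing homeomorphism of `ℝ` commuting with the unit translation and
lifting the permutation `f` of the circle. -/
def IsOrderLift (f : Equiv.Perm S1) (F : ℝ ≃o ℝ) : Prop :=
  (∀ x : ℝ, F (x + 1) = F x + 1) ∧ ∀ x : ℝ, f (x : S1) = (F x : S1)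

theorem coe_eq_coe_iff_exists_int {x y : ℝ} : (x : S1) = y ↔ ∃ k : ℤ, y = x + k := by
  rw [eq_comm, ← sub_eq_zero, ← AddCircle.coe_sub, AddCircle.coe_eq_zero_iff]
  refine exists_congr fun k => ?_
  simp only [zsmul_eq_mul, mul_one]
  constructor <;> intro h <;> linarith

theorem apply_add_int {F : ℝ → ℝ} (hF : ∀ x, F (x + 1) = F x + 1) (x : ℝ) (k : ℤ) :
    F (x + k) = F x + k := by
  induction k using Int.induction_on with
  | zero => simp
  | succ n ih =>
    push_cast at ih ⊢
    rw [← add_assoc, hF, ih, add_assoc]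
  | pred n ih =>
    push_cast at ih ⊢
    have := hF (x + (-n - 1))
    rw [show x + (-(n : ℝ) - 1) + 1 = x + -n by ring, ih] at this
    linarith

theorem surjective_of_apply_add_one {F : ℝ → ℝ} (hc : Continuous F)
    (hF : ∀ x, F (x + 1) = F x + 1) : Function.Surjective F := by
  intro y
  have h1 : F (0 + (⌊y - F 0⌋ : ℤ)) ≤ y := by
    rw [apply_add_int hF]; linarith [Int.floor_le (y - F 0)]
  have h2 : y ≤ F (0 + (⌈y - F 0⌉ : ℤ)) := by
    rw [apply_add_int hF]; linarith [Int.le_ceil (y - F 0)]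
  exact mem_range_of_exists_le_of_exists_ge hc ⟨_, h1⟩ ⟨_, h2⟩

theorem IsPosHomeo.exists_isOrderLift {f : Equiv.Perm S1} (hf : IsPosHomeo f) :
    ∃ F, IsOrderLift f F := by
  obtain ⟨F, hm, hc, h1, hl⟩ := hf
  exact ⟨hm.orderIsoOfSurjective F (surjective_of_apply_add_one hc h1), h1, hl⟩

namespace IsOrderLift

variable {f g : Equiv.Perm S1} {F E : ℝ ≃o ℝ}

theorem mul (hf : IsOrderLift f F) (hg : IsOrderLift g E) : IsOrderLift (f * g) (F * E) :=
  ⟨fun x => by simp [RelIso.mul_apply, hg.1, hf.1],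
    fun x => by simp [RelIso.mul_apply, hg.2, hf.2]⟩

theorem one : IsOrderLift 1 1 := ⟨fun _ => rfl, fun _ => rfl⟩

theorem inv (hf : IsOrderLift f F) : IsOrderLift f⁻¹ F⁻¹ := by
  refine ⟨fun x => F.injective ?_, fun x => f.injective ?_⟩
  · rw [hf.1, RelIso.apply_inv_self, RelIso.apply_inv_self]
  · rw [hf.2, RelIso.apply_inv_self, Equiv.Perm.coe_inv, Equiv.apply_symm_apply]

/-- A lift of a map fixing the class of `p` can be chosen to fix `p`. -/
theorem exists_apply_eq (hf : IsOrderLift f F) {p : ℝ} (hp : f (p : S1) = p) :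
    ∃ E, IsOrderLift f E ∧ E p = p := by
  rw [hf.2] at hp
  obtain ⟨k, hk⟩ := coe_eq_coe_iff_exists_int.1 hp
  refine ⟨F.trans (OrderIso.addRight (k : ℝ)), ⟨fun x => ?_, fun x => ?_⟩, ?_⟩
  · simp [hf.1, add_right_comm]
  · rw [hf.2]
    exact coe_eq_coe_iff_exists_int.2 ⟨k, rfl⟩
  · simpa using hk.symm

/-- If a lift has a fixed point, its fixed points are exactly the preimages of those of
the circle map. -/
theorem apply_eq_iff (hf : IsOrderLift f F) {p : ℝ} (hp : F p = p) (x : ℝ) :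
    f (x : S1) = x ↔ F x = x := by
  refine ⟨fun h => ?_, fun h => by rw [hf.2, h]⟩
  rw [hf.2] at h
  obtain ⟨k, hk⟩ := coe_eq_coe_iff_exists_int.1 h
  have h1 : p + ⌊x - p⌋ ≤ x := by linarith [Int.floor_le (x - p)]
  have h2 : x < p + (⌊x - p⌋ + 1 : ℤ) := by push_cast; linarith [Int.lt_floor_add_one (x - p)]
  have h3 := F.monotone h1
  have h4 := F.strictMono h2
  rw [apply_add_int hf.1, hp] at h3 h4
  push_cast at h2 h4
  have h5 : (k : ℝ) < 1 := by linarith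
  have h6 : (-1 : ℝ) < k := by linarith
  have : k = 0 := by
    have h7 : k < 1 := by exact_mod_cast h5
    have h8 : -1 < k := by exact_mod_cast h6
    omega
  subst this
  simpa using hk.symm

theorem continuous (hf : IsOrderLift f F) : Continuous f := by
  refine (QuotientAddGroup.isQuotientMap_mk _).continuous_iff.2 ?_
  have : (f ∘ QuotientAddGroup.mk : ℝ → S1) = fun x : ℝ => (F x : S1) := funext hf.2
  exact this ▸ (AddCircle.continuous_mk' 1).comp F.continuous

theorem isClosed_fixed (hf : IsOrderLift f F) : IsClosed {x | f x = x} :=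
  isClosed_eq hf.continuous continuous_id

end IsOrderLift

theorem exists_tendsto_iterate (F : ℝ ≃o ℝ) {p q x : ℝ} (hp : F p = p) (hq : F q = q)
    (hpx : p ≤ x) (hxq : x ≤ q) :
    ∃ L, F L = L ∧ Tendsto (fun n => F^[n] x) atTop (𝓝 L) := by
  have hb1 : ∀ n, p ≤ F^[n] x := fun n => by
    simpa [Function.iterate_fixed hp] using F.monotone.iterate n hpx
  have hb2 : ∀ n, F^[n] x ≤ q := fun n => by
    simpa [Function.iterate_fixed hq] using F.monotone.iterate n hxq
  have key : ∃ L, Tendsto (fun n => F^[n] x) atTop (𝓝 L) := by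
    rcases le_total x (F x) with h | h
    · exact ⟨_, tendsto_atTop_ciSup (F.monotone.monotone_iterate_of_le_map h)
        ⟨q, by rintro _ ⟨n, rfl⟩; exact hb2 n⟩⟩
    · exact ⟨_, tendsto_atTop_ciInf (F.monotone.antitone_iterate_of_map_le h)
        ⟨p, by rintro _ ⟨n, rfl⟩; exact hb1 n⟩⟩
  obtain ⟨L, hL⟩ := key
  exact ⟨L, isFixedPt_of_tendsto_iterate hL F.continuous.continuousAt, hL⟩

/-- Near a point which is not fixed, the iterates of an increasing homeomorphism converge
uniformly to a fixed point. -/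
theorem exists_nhds_eventually_iterate_mem (F : ℝ ≃o ℝ) {p q x : ℝ} (hp : F p = p)
    (hq : F q = q) (hpx : p ≤ x) (hxq : x ≤ q) (hx : F x ≠ x) {U : Set ℝ} (hU : IsOpen U)
    (hFU : ∀ y, F y = y → y ∈ U) :
    ∃ V ∈ 𝓝 x, ∀ᶠ n in atTop, ∀ y ∈ V, F^[n] y ∈ U := by
  obtain ⟨L, hL, hlim⟩ := exists_tendsto_iterate F hp hq hpx hxq
  have h1 : Tendsto (fun n => F^[n] (F x)) atTop (𝓝 L) := by
    simpa only [← Function.iterate_succ_apply] using (tendsto_add_atTop_iff_nat 1).2 hlim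
  have h2 : Tendsto (fun n => F^[n] (F.symm x)) atTop (𝓝 L) := by
    refine (tendsto_add_atTop_iff_nat 1).1 ?_
    simpa only [Function.iterate_succ_apply, OrderIso.apply_symm_apply] using hlim
  obtain ⟨u, v, hu, hv, huL, hvL⟩ : ∃ u v, u < x ∧ x < v ∧
      Tendsto (fun n => F^[n] u) atTop (𝓝 L) ∧ Tendsto (fun n => F^[n] v) atTop (𝓝 L) := by
    rcases lt_or_gt_of_ne hx with h | h
    · exact ⟨_, _, h, by rwa [F.lt_symm_apply], h1, h2⟩
    · exact ⟨_, _, by rwa [F.symm_apply_lt], h, h2, h1⟩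
  obtain ⟨ε, hε, hball⟩ := Metric.isOpen_iff.1 hU L (hFU L hL)
  refine ⟨Set.Ioo u v, Ioo_mem_nhds hu hv, ?_⟩
  filter_upwards [huL (Metric.ball_mem_nhds L hε), hvL (Metric.ball_mem_nhds L hε)]
    with n hnu hnv y hy
  refine hball ?_
  rw [Set.mem_preimage, Real.ball_eq_Ioo] at hnu hnv
  rw [Real.ball_eq_Ioo]
  exact ⟨hnu.1.trans_le (F.monotone.iterate n hy.1.le),
    (F.monotone.iterate n hy.2.le).trans_lt hnv.2⟩

theorem IsOrderLift.eventually_pow_mem {f : Equiv.Perm S1} {F : ℝ ≃o ℝ} (hf : IsOrderLift f F)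
    {p : ℝ} (hp : F p = p) {U : Set S1} (hU : IsOpen U) (hfU : {x | f x = x} ⊆ U) :
    ∀ᶠ n : ℕ in atTop, ∀ x ∉ U, (f ^ n) x ∈ U := by
  set π : ℝ → S1 := fun x => (x : S1) with hπ
  have hπc : Continuous π := AddCircle.continuous_mk' 1
  have hK : IsCompact (Set.Icc p (p + 1) ∩ (π ⁻¹' U)ᶜ) :=
    isCompact_Icc.inter_right (hU.preimage hπc).isClosed_compl
  have key : ∀ᶠ n : ℕ in atTop, ∀ y ∈ Set.Icc p (p + 1) ∩ (π ⁻¹' U)ᶜ, F^[n] y ∈ π ⁻¹' U := by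
    refine hK.induction_on (p := fun s => ∀ᶠ n : ℕ in atTop, ∀ y ∈ s, F^[n] y ∈ π ⁻¹' U)
      (by simp) (fun s t hst ht => ht.mono fun n hn y hy => hn y (hst hy)) ?_ ?_
    · intro s t hs ht
      filter_upwards [hs, ht] with n h1 h2 y hy
      exact hy.elim (h1 y) (h2 y)
    · intro x hx
      have hfix : ∀ y, F y = y → y ∈ π ⁻¹' U := fun y hy => hfU ((hf.apply_eq_iff hp y).2 hy)
      obtain ⟨V, hV, h⟩ := exists_nhds_eventually_iterate_mem F hp (q := p + 1)
        (by rw [hf.1, hp]) hx.1.1 hx.1.2 (fun h => hx.2 (hfix x h)) (hU.preimage hπc) hfix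
      exact ⟨V, mem_nhdsWithin_of_mem_nhds hV, h⟩
  filter_upwards [key] with n hn x hx
  obtain ⟨y, hy, rfl⟩ : x ∈ π '' Set.Icc p (p + 1) := by
    rw [hπ, AddCircle.coe_image_Icc_eq]; trivial
  have h1 := hn y ⟨hy, hx⟩
  have h2 : Function.Semiconj π F f := fun z => (hf.2 z).symm
  rw [Set.mem_preimage, (h2.iterate_right n).eq, Equiv.Perm.iterate_eq_pow] at h1
  exact h1

theorem IsOrderLift.exists_zpow_mem {f : Equiv.Perm S1} {F : ℝ ≃o ℝ} (hf : IsOrderLift f F)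
    {p : ℝ} (hp : F p = p) {U : Set S1} (hU : IsOpen U) (hfU : {x | f x = x} ⊆ U) :
    ∃ N : ℕ, ∀ n : ℤ, N ≤ n.natAbs → ∀ x ∉ U, (f ^ n) x ∈ U := by
  have h1 := hf.eventually_pow_mem hp hU hfU
  have h2 := hf.inv.eventually_pow_mem (p := p) (F.injective (by
    rw [RelIso.apply_inv_self, hp])) hU (fun x hx => hfU (by
      rw [Set.mem_ofPred_eq, Equiv.Perm.inv_eq_iff_eq] at hx; exact hx.symm))
  obtain ⟨N, hN⟩ := eventually_atTop.1 (h1.and h2)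
  refine ⟨N, fun n hn x hx => ?_⟩
  rcases Int.natAbs_eq n with h | h <;> rw [h]
  · rw [zpow_natCast]; exact (hN _ hn).1 x hx
  · rw [zpow_neg, zpow_natCast, ← inv_pow]; exact (hN _ hn).2 x hx

/-- Ping-pong for two permutations all of whose nontrivial powers map the complement of a
set into that set, the two sets being disjoint. -/
theorem injective_freeGroup_lift_of_zpow_mem {α : Type*} (a : Fin 2 → Equiv.Perm α)
    (X : Fin 2 → Set α) (hne : ∀ i, (X i).Nonempty) (hdisj : Disjoint (X 0) (X 1))
    (h : ∀ i, ∀ n : ℤ, n ≠ 0 → ∀ x ∉ X i, (a i ^ n) x ∈ X i) :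
    Function.Injective (FreeGroup.lift a) := by
  have hX : Pairwise (Function.onFun Disjoint X) := by
    intro i j hij
    fin_cases i <;> fin_cases j <;> first | exact absurd rfl hij | exact hdisj | exact hdisj.symm
  have hcomp : FreeGroup.lift a =
      (Monoid.CoprodI.lift fun i => FreeGroup.lift fun _ : Unit => a i).comp
        (@freeGroupEquivCoprodI (Fin 2)).toMonoidHom := by
    ext i
    simp
  rw [hcomp, MonoidHom.coe_comp]
  refine Function.Injective.comp ?_ (MulEquiv.injective freeGroupEquivCoprodI)
  refine Monoid.CoprodI.lift_injective_of_ping_pong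
    (fun i => FreeGroup.lift fun _ : Unit => a i) (Or.inr ⟨0, ?_⟩) X hne hX ?_
  · rw [FreeGroup.freeGroupUnitEquivInt.cardinal_eq, Cardinal.mk_denumerable]
    exact Cardinal.natCast_le_aleph0
  · intro i j hij
    refine FreeGroup.freeGroupUnitEquivInt.forall_congr_left.mpr fun n hn => ?_
    have hn0 : n ≠ 0 := by
      rintro rfl
      exact hn (by simp [FreeGroup.freeGroupUnitEquivInt])
    change FreeGroup.lift (fun _ => a i) (FreeGroup.of () ^ n) • X j ⊆ X i
    rw [map_zpow, FreeGroup.lift_apply_of]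
    rintro _ ⟨x, hx, rfl⟩
    exact h i n hn0 x fun hxi => Set.disjoint_left.1 (hX hij) hxi hx

/-- Two circle homeomorphisms with nonempty disjoint fixed point sets have powers that
generate a free group. -/
theorem hasFreeSubgroup_of_disjoint_fixed {G : Subgroup (Equiv.Perm S1)}
    {f g : Equiv.Perm S1} (hfG : f ∈ G) (hgG : g ∈ G) {F E : ℝ ≃o ℝ} (hf : IsOrderLift f F)
    (hg : IsOrderLift g E) {p q : ℝ} (hp : F p = p) (hq : E q = q)
    (hdisj : ∀ x, f x = x → g x ≠ x) : HasFreeSubgroup G := by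
  obtain ⟨U, V, hU, hV, hfU, hgV, hUV⟩ := normal_separation
    hf.isClosed_fixed hg.isClosed_fixed (Set.disjoint_left.2 hdisj)
  obtain ⟨M, hM⟩ := hf.exists_zpow_mem hp hU hfU
  obtain ⟨N, hN⟩ := hg.exists_zpow_mem hq hV hgV
  refine ⟨FreeGroup.lift ![f ^ (M + N), g ^ (M + N)],
    injective_freeGroup_lift_of_zpow_mem _ ![U, V] ?_ hUV ?_, ?_⟩
  · rw [Fin.forall_fin_two]
    exact ⟨⟨p, hfU ((hf.apply_eq_iff hp p).2 hp)⟩, ⟨q, hgV ((hg.apply_eq_iff hq q).2 hq)⟩⟩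
  · have hbound : ∀ n : ℤ, n ≠ 0 → M + N ≤ (((M + N : ℕ) : ℤ) * n).natAbs := fun n hn => by
      rw [Int.natAbs_mul, Int.natAbs_natCast]
      exact Nat.le_mul_of_pos_right _ (Int.natAbs_pos.2 hn)
    rw [Fin.forall_fin_two]
    refine ⟨fun n hn x hx => ?_, fun n hn x hx => ?_⟩
    · have := hM _ (le_trans (by omega) (hbound n hn)) x hx
      rwa [zpow_mul, zpow_natCast] at this
    · have := hN _ (le_trans (by omega) (hbound n hn)) x hx
      rwa [zpow_mul, zpow_natCast] at this
  · intro w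
    have hle : (FreeGroup.lift ![f ^ (M + N), g ^ (M + N)]).range ≤ G := by
      rw [FreeGroup.range_lift_eq_closure, Subgroup.closure_le]
      rintro _ ⟨i, rfl⟩
      fin_cases i
      exacts [G.pow_mem hfG _, G.pow_mem hgG _]
    exact hle ⟨w, rfl⟩

theorem exists_lt_apply_of_no_fixed (Γ : Subgroup (ℝ ≃o ℝ)) {a b : ℝ}
    (h : ∀ x ∈ Set.Icc a b, ∃ t ∈ Γ, t x ≠ x) : ∃ t ∈ Γ, b < t a := by
  by_contra! hcon
  set O : Set ℝ := {y | ∃ t ∈ Γ, t a = y} with hO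
  have hne : O.Nonempty := ⟨a, 1, Γ.one_mem, rfl⟩
  have hub : b ∈ upperBounds O := by rintro _ ⟨t, ht, rfl⟩; exact hcon t ht
  have hlub : IsLUB O (sSup O) := isLUB_csSup hne ⟨b, hub⟩
  have hle : ∀ t ∈ Γ, t (sSup O) ≤ sSup O := by
    intro t ht
    rw [← OrderIso.le_symm_apply]
    refine hlub.2 ?_
    rintro _ ⟨s, hs, rfl⟩
    rw [OrderIso.le_symm_apply]
    exact hlub.1 ⟨t * s, Γ.mul_mem ht hs, rfl⟩
  obtain ⟨t, ht, hne'⟩ := h (sSup O) ⟨hlub.1 ⟨1, Γ.one_mem, rfl⟩, hlub.2 hub⟩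
  refine hne' (le_antisymm (hle t ht) ?_)
  have := t.monotone (hle t⁻¹ (Γ.inv_mem ht))
  rwa [RelIso.apply_inv_self] at this

/-- If a group of increasing homeomorphisms of `ℝ` has no global fixed point in each of
finitely many compact intervals, a single element displaces all of these intervals. -/
theorem exists_displacing (Γ : Subgroup (ℝ ≃o ℝ)) {ι : Type*} (s : Finset ι) (a b : ι → ℝ)
    (h : ∀ i ∈ s, ∀ x ∈ Set.Icc (a i) (b i), ∃ t ∈ Γ, t x ≠ x) :
    ∃ f ∈ Γ, ∀ i ∈ s, f (b i) < a i ∨ b i < f (a i) := by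
  classical
  induction s using Finset.induction_on generalizing a b with
  | empty => exact ⟨1, Γ.one_mem, by simp⟩
  | insert j s hj ih =>
    obtain ⟨t, ht, hlt⟩ := exists_lt_apply_of_no_fixed Γ (h j (by simp))
    obtain ⟨f, hf, hfs⟩ := ih (fun i => min (a i) (t (a i))) (fun i => max (b i) (t (b i))) (by
        intro i hi x hx
        by_contra! hfix
        by_cases hxi : x ∈ Set.Icc (a i) (b i)
        · obtain ⟨u, hu, hne⟩ := h i (Finset.mem_insert_of_mem hi) x hxi
          exact hne (hfix u hu)
        · rw [Set.mem_Icc, not_and_or, not_le, not_le] at hxi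
          rcases hxi with hxi | hxi
          · have := t.strictMono hxi
            rw [hfix t ht] at this
            exact (lt_min hxi this).not_ge hx.1
          · have := t.strictMono hxi
            rw [hfix t ht] at this
            exact (max_lt hxi this).not_ge hx.2)
    have hinv : ∀ x y, t⁻¹ x < y ↔ x < t y := fun x y => t.symm_apply_lt
    have hinv' : ∀ x y, x < t⁻¹ y ↔ t x < y := fun x y => t.lt_symm_apply
    have hsmall : ∀ i ∈ s, (f (b i) < a i ∧ f (t (b i)) < a i ∧ f (b i) < t (a i) ∧
        f (t (b i)) < t (a i)) ∨ (b i < f (a i) ∧ b i < f (t (a i)) ∧ t (b i) < f (a i) ∧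
        t (b i) < f (t (a i))) := by
      intro i hi
      have hb1 := f.monotone (le_max_left (b i) (t (b i)))
      have hb2 := f.monotone (le_max_right (b i) (t (b i)))
      have ha1 := f.monotone (min_le_left (a i) (t (a i)))
      have ha2 := f.monotone (min_le_right (a i) (t (a i)))
      refine (hfs i hi).imp (fun hlt => ?_) (fun hlt => ?_)
      · rw [lt_min_iff] at hlt
        exact ⟨hb1.trans_lt hlt.1, hb2.trans_lt hlt.1, hb1.trans_lt hlt.2, hb2.trans_lt hlt.2⟩
      · rw [max_lt_iff] at hlt
        exact ⟨hlt.1.trans_le ha1, hlt.1.trans_le ha2, hlt.2.trans_le ha1, hlt.2.trans_le ha2⟩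
    have hcases : (f (b j) < a j ∨ b j < f (a j)) ∨ (f (t (b j)) < a j ∨ b j < f (t (a j))) ∨
        (f (b j) < t (a j) ∨ t (b j) < f (a j)) := by
      by_contra! hcon
      linarith [f.strictMono hlt, hcon.2.1.2, hcon.2.2.1]
    rcases hcases with hc | hc | hc
    · refine ⟨f, hf, fun i hi => ?_⟩
      rcases Finset.mem_insert.1 hi with rfl | hi
      · exact hc
      · exact (hsmall i hi).imp (fun h => h.1) (fun h => h.1)
    · refine ⟨f * t, Γ.mul_mem hf ht, fun i hi => ?_⟩
      simp only [RelIso.mul_apply]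
      rcases Finset.mem_insert.1 hi with rfl | hi
      · exact hc
      · exact (hsmall i hi).imp (fun h => h.2.1) (fun h => h.2.1)
    · refine ⟨t⁻¹ * f, Γ.mul_mem (Γ.inv_mem ht) hf, fun i hi => ?_⟩
      simp only [RelIso.mul_apply, hinv, hinv']
      rcases Finset.mem_insert.1 hi with rfl | hi
      · exact hc
      · exact (hsmall i hi).imp (fun h => h.2.2.1) (fun h => h.2.2.1)

/-- If a group of increasing homeomorphisms of `ℝ` has no global fixed point in a compact
set, a single element has no fixed point there. -/
theorem exists_forall_apply_ne_of_isCompact (Γ : Subgroup (ℝ ≃o ℝ)) {C : Set ℝ}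
    (hC : IsCompact C) (h : ∀ x ∈ C, ∃ t ∈ Γ, t x ≠ x) : ∃ f ∈ Γ, ∀ x ∈ C, f x ≠ x := by
  have hloc : ∀ x, ∃ ε > 0, x ∈ C → ∀ y ∈ Set.Icc (x - ε) (x + ε), ∃ t ∈ Γ, t y ≠ y := by
    intro x
    by_cases hx : x ∈ C
    · obtain ⟨t, ht, hne⟩ := h x hx
      have hopen : {y | t y ≠ y} ∈ 𝓝 x :=
        (isOpen_ne_fun t.continuous continuous_id).mem_nhds hne
      obtain ⟨ε, hε, hsub⟩ := Metric.nhds_basis_closedBall.mem_iff.1 hopen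
      rw [Real.closedBall_eq_Icc] at hsub
      exact ⟨ε, hε, fun _ y hy => ⟨t, ht, hsub hy⟩⟩
    · exact ⟨1, one_pos, fun h => absurd h hx⟩
  choose ε hε hgood using hloc
  obtain ⟨s, hsC, hcov⟩ := hC.elim_nhds_subcover (fun x => Set.Icc (x - ε x) (x + ε x))
    fun x _ => Icc_mem_nhds (by linarith [hε x]) (by linarith [hε x])
  obtain ⟨f, hf, hdis⟩ := exists_displacing Γ s (fun x => x - ε x) (fun x => x + ε x)
    (fun x hx => hgood x (hsC x hx))
  refine ⟨f, hf, fun y hy heq => ?_⟩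
  obtain ⟨x, hx, hyx⟩ := Set.mem_iUnion₂.1 (hcov hy)
  have h1 := f.monotone hyx.1
  have h2 := f.monotone hyx.2
  rcases hdis x hx with h3 | h3 <;> linarith [hyx.1, hyx.2]

/-- The lifts fixing `p` of elements of `H`. -/
def liftStabilizer (H : Subgroup (Equiv.Perm S1)) (p : ℝ) : Subgroup (ℝ ≃o ℝ) where
  carrier := {F | F p = p ∧ ∃ f ∈ H, IsOrderLift f F}
  one_mem' := ⟨rfl, 1, H.one_mem, IsOrderLift.one⟩
  mul_mem' := by
    rintro F E ⟨hF, f, hf, hfF⟩ ⟨hE, g, hg, hgE⟩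
    exact ⟨by rw [RelIso.mul_apply, hE, hF], f * g, H.mul_mem hf hg, hfF.mul hgE⟩
  inv_mem' := by
    rintro F ⟨hF, f, hf, hfF⟩
    exact ⟨F.injective (by rw [RelIso.apply_inv_self, hF]), f⁻¹, H.inv_mem hf, hfF.inv⟩

theorem iInter_fixed_nonempty_of_finset {G : Subgroup (Equiv.Perm S1)}
    (hpos : ∀ g ∈ G, IsPosHomeo g) (hfree : ¬ HasFreeSubgroup G) (s : Finset (Equiv.Perm S1))
    (hs : ∀ g ∈ s, g ∈ G ∧ {x : S1 | g x = x}.Nonempty) :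
    (⋂ g ∈ s, {x : S1 | g x = x}).Nonempty := by
  classical
  induction s using Finset.induction_on with
  | empty => exact ⟨0, by simp⟩
  | insert g s _ ih =>
    obtain ⟨x, hx⟩ := ih fun k hk => hs k (Finset.mem_insert_of_mem hk)
    obtain ⟨p, rfl⟩ := QuotientAddGroup.mk_surjective x
    have hfixp : ∀ k ∈ s, k (p : S1) = p := fun k hk => Set.mem_iInter₂.1 hx k hk
    obtain ⟨hgG, y, hy⟩ := hs g (Finset.mem_insert_self _ _)
    obtain ⟨q, rfl⟩ := QuotientAddGroup.mk_surjective y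
    obtain ⟨E₀, hE₀⟩ := (hpos g hgG).exists_isOrderLift
    obtain ⟨E, hgE, hEq⟩ := hE₀.exists_apply_eq hy
    by_contra hempty
    have hC : IsCompact (Set.Icc 0 1 ∩ {x | E x = x}) :=
      isCompact_Icc.inter_right (isClosed_eq E.continuous continuous_id)
    obtain ⟨F, ⟨hFp, f, hfH, hfF⟩, hF⟩ := exists_forall_apply_ne_of_isCompact
      (liftStabilizer (Subgroup.closure (s : Set (Equiv.Perm S1))) p) hC (by
        rintro z ⟨-, hz⟩
        by_contra! hfix
        refine hempty ⟨(z : S1), Set.mem_iInter₂.2 fun k hk => ?_⟩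
        rcases Finset.mem_insert.1 hk with rfl | hk
        · exact (hgE.apply_eq_iff hEq z).2 hz
        · obtain ⟨K₀, hK₀⟩ := (hpos k (hs k (Finset.mem_insert_of_mem hk)).1).exists_isOrderLift
          obtain ⟨K, hkK, hKp⟩ := hK₀.exists_apply_eq (hfixp k hk)
          exact (hkK.apply_eq_iff hKp z).2
            (hfix K ⟨hKp, k, Subgroup.subset_closure hk, hkK⟩))
    have hfG : f ∈ G := (Subgroup.closure_le G).2
      (fun k hk => (hs k (Finset.mem_insert_of_mem hk)).1) hfH
    refine hfree (hasFreeSubgroup_of_disjoint_fixed hfG hgG hfF hgE hFp hEq fun z hfz hgz => ?_)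
    obtain ⟨w, hw, rfl⟩ := AddCircle.eq_coe_Ico z
    exact hF w ⟨⟨hw.1, hw.2.le⟩, (hgE.apply_eq_iff hEq w).1 hgz⟩
      ((hfF.apply_eq_iff hFp w).1 hfz)

/-- For a subgroup G of Homeo₊(S¹) with no non-abelian free subgroup, the fixed point
sets of elements with fixed points have the finite intersection property, and the
elements with fixed points admit a common global fixed point. -/
theorem stmt6 (G : Subgroup (Equiv.Perm S1)) (hpos : ∀ g ∈ G, IsPosHomeo g)
    (hfree : ¬ HasFreeSubgroup G) :
    (∀ s : Finset (Equiv.Perm S1),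
        (∀ g ∈ s, g ∈ G ∧ {x : S1 | g x = x}.Nonempty) →
        (⋂ g ∈ s, {x : S1 | g x = x}).Nonempty) ∧
      (⋂ g ∈ {g : Equiv.Perm S1 | g ∈ G ∧ {x : S1 | g x = x}.Nonempty},
        {x : S1 | g x = x}).Nonempty := by
  classical
  have hfip := iInter_fixed_nonempty_of_finset hpos hfree
  refine ⟨hfip, ?_⟩
  rw [Set.biInter_eq_iInter]
  have hcpt := isCompact_univ.inter_iInter_nonempty
    (fun g : {g : Equiv.Perm S1 | g ∈ G ∧ {x : S1 | g x = x}.Nonempty} => {x : S1 | g.1 x = x})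
    (fun g => (hpos g.1 g.2.1).exists_isOrderLift.choose_spec.isClosed_fixed) (by
      intro u
      obtain ⟨x, hx⟩ := hfip (u.image Subtype.val) (by
        intro g hg
        obtain ⟨k, -, rfl⟩ := Finset.mem_image.1 hg
        exact k.2)
      exact ⟨x, trivial, Set.mem_iInter₂.2 fun k hk =>
        Set.mem_iInter₂.1 hx k.1 (Finset.mem_image_of_mem _ hk)⟩)
  rwa [Set.univ_inter] at hcpt
end

section
/- Let G ≤ Homeo₊(S¹) be a subgroup with no non-abelian free subgroup. Then the rotation number map rot : G → ℝ/ℤ is a group homomorphism. -/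
section Helpers

open Filter Set Topology Function

namespace FreeGroup

open scoped Pointwise in
/-- A ping-pong lemma for two-sided dynamics: all nontrivial powers of `a i` map the ping-pong
sets of the other generators into that of `a i`. -/
theorem injective_lift_of_zpow_ping_pong {ι G α : Type*} [Nontrivial ι] [Group G] [MulAction G α]
    (a : ι → G) (X : ι → Set α) (hne : ∀ i, (X i).Nonempty)
    (hdisj : Pairwise fun i j => Disjoint (X i) (X j))
    (hpp : ∀ i j, i ≠ j → ∀ n : ℤ, n ≠ 0 → ∀ x ∈ X j, a i ^ n • x ∈ X i) :
    Injective (FreeGroup.lift a) := by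
  have hlift : FreeGroup.lift a =
      (Monoid.CoprodI.lift fun i => FreeGroup.lift fun _ : Unit => a i).comp
        (@freeGroupEquivCoprodI ι).toMonoidHom := by
    ext i
    simp
  rw [hlift, MonoidHom.coe_comp]
  refine Injective.comp ?_ (MulEquiv.injective freeGroupEquivCoprodI)
  refine Monoid.CoprodI.lift_injective_of_ping_pong (H := fun _ : ι => FreeGroup Unit)
    (fun i => FreeGroup.lift fun _ : Unit => a i) ?_ X hne hdisj ?_
  · inhabit ι
    refine Or.inr ⟨default, ?_⟩
    rw [FreeGroup.freeGroupUnitEquivInt.cardinal_eq, Cardinal.mk_denumerable]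
    exact Cardinal.natCast_le_aleph0
  · intro i j hij
    refine FreeGroup.freeGroupUnitEquivInt.forall_congr_left.mpr ?_
    intro n hn
    have hn0 : n ≠ 0 := by
      rintro rfl
      apply hn
      simp [FreeGroup.freeGroupUnitEquivInt]
    change FreeGroup.lift (fun _ => a i) (FreeGroup.of () ^ n) • X j ⊆ X i
    simp only [map_zpow, FreeGroup.lift_apply_of]
    rintro _ ⟨x, hx, rfl⟩
    exact hpp i j hij n hn0 x hx

end FreeGroup

namespace OrderIso

/-- Under iteration of an increasing homeomorphism of `[p, q]`, points converge locally uniformly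
to fixed points away from the fixed point set. -/
theorem exists_forall_iterate_mem_nhds (H : ℝ ≃o ℝ) {p q : ℝ} (hp : H p = p) (hq : H q = q)
    {W : Set ℝ} (hW : IsOpen W) (hfix : ∀ x ∈ Icc p q, H x = x → x ∈ W) {x : ℝ}
    (hx : x ∈ Icc p q) (hxW : x ∉ W) :
    ∃ A ∈ 𝓝 x, ∃ N : ℕ, ∀ n ≥ N, ∀ y ∈ A, H^[n] y ∈ W := by
  have hmaps : ∀ n, H^[n] x ∈ Icc p q := fun n =>
    (MapsTo.iterate (fun y hy => ⟨hp ▸ H.monotone hy.1, hq ▸ H.monotone hy.2⟩ :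
      MapsTo H (Icc p q) (Icc p q)) n) hx
  obtain ⟨z, hz⟩ : ∃ z, Tendsto (fun n => H^[n] x) atTop (𝓝 z) := by
    rcases le_total x (H x) with h | h
    · exact ⟨_, tendsto_atTop_ciSup (H.monotone.monotone_iterate_of_le_map h)
        ⟨q, by rintro _ ⟨n, rfl⟩; exact (hmaps n).2⟩⟩
    · exact ⟨_, tendsto_atTop_ciInf (H.monotone.antitone_iterate_of_map_le h)
        ⟨p, by rintro _ ⟨n, rfl⟩; exact (hmaps n).1⟩⟩
  have hzW : z ∈ W := hfix z (isClosed_Icc.mem_of_tendsto hz (Eventually.of_forall hmaps))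
    (isFixedPt_of_tendsto_iterate hz H.continuous.continuousAt)
  have hz1 : Tendsto (fun n => H^[n] (H x)) atTop (𝓝 z) := (tendsto_add_atTop_iff_nat 1).2 hz
  have hz2 : Tendsto (fun n => H^[n] (H.symm x)) atTop (𝓝 z) := by
    refine (tendsto_add_atTop_iff_nat 1).1 ?_
    simpa using hz
  obtain ⟨l, u, ⟨hl, hu⟩, hlu⟩ := mem_nhds_iff_exists_Ioo_subset.1 (hW.mem_nhds hzW)
  have key : ∀ a b : ℝ, Tendsto (fun n => H^[n] a) atTop (𝓝 z) →
      Tendsto (fun n => H^[n] b) atTop (𝓝 z) → a < x → x < b →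
      ∃ A ∈ 𝓝 x, ∃ N : ℕ, ∀ n ≥ N, ∀ y ∈ A, H^[n] y ∈ W := by
    intro a b ha hb hax hxb
    refine ⟨Icc a b, Icc_mem_nhds hax hxb, ?_⟩
    obtain ⟨N, hN⟩ := eventually_atTop.1 ((ha.eventually (lt_mem_nhds hl)).and
      (hb.eventually (gt_mem_nhds hu)))
    refine ⟨N, fun n hn y hy => hlu ⟨?_, ?_⟩⟩
    · exact (hN n hn).1.trans_le (H.monotone.iterate n hy.1)
    · exact (H.monotone.iterate n hy.2).trans_lt (hN n hn).2
  have hne : H x ≠ x := fun h => hxW (hfix x hx h)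
  rcases lt_or_gt_of_ne hne with h | h
  · exact key _ _ hz1 hz2 h (H.lt_symm_apply.2 h)
  · exact key _ _ hz2 hz1 (H.symm_apply_lt.2 h) h

theorem exists_forall_iterate_mem (H : ℝ ≃o ℝ) {p q : ℝ} (hp : H p = p) (hq : H q = q)
    {W : Set ℝ} (hW : IsOpen W) (hfix : ∀ x ∈ Icc p q, H x = x → x ∈ W) :
    ∃ N : ℕ, ∀ n ≥ N, ∀ x ∈ Icc p q \ W, H^[n] x ∈ W := by
  refine (isCompact_Icc.diff hW).induction_on
    (p := fun s => ∃ N : ℕ, ∀ n ≥ N, ∀ x ∈ s, H^[n] x ∈ W) ⟨0, by simp⟩ ?_ ?_ ?_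
  · rintro s t hst ⟨N, hN⟩
    exact ⟨N, fun n hn x hx => hN n hn x (hst hx)⟩
  · rintro s t ⟨N, hN⟩ ⟨M, hM⟩
    refine ⟨max N M, fun n hn x hx => ?_⟩
    rcases hx with hx | hx
    · exact hN n (le_of_max_le_left hn) x hx
    · exact hM n (le_of_max_le_right hn) x hx
  · rintro x ⟨hx, hxW⟩
    obtain ⟨A, hA, h⟩ := H.exists_forall_iterate_mem_nhds hp hq hW hfix hx hxW
    exact ⟨A, mem_nhdsWithin_of_mem_nhds hA, h⟩

end OrderIso

/-- The interval `[J.1, J.2]` is nonempty and contains no global fixed point of `Γ`. -/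
def FixedPointFreeInterval (Γ : Subgroup (ℝ ≃o ℝ)) (J : ℝ × ℝ) : Prop :=
  J.1 ≤ J.2 ∧ ∀ x ∈ Icc J.1 J.2, ∃ w ∈ Γ, w x ≠ x

namespace FixedPointFreeInterval

variable {Γ : Subgroup (ℝ ≃o ℝ)}

theorem exists_lt_map {J : ℝ × ℝ} (hJ : FixedPointFreeInterval Γ J) : ∃ v ∈ Γ, J.2 < v J.1 := by
  by_contra! hcon
  set S : Set ℝ := {y | ∃ v ∈ Γ, v J.1 = y}
  have hbdd : BddAbove S := ⟨J.2, by rintro _ ⟨v, hv, rfl⟩; exact hcon v hv⟩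
  have hmem : J.1 ∈ S := ⟨1, Γ.one_mem, rfl⟩
  have hlt : ∀ w ∈ Γ, ¬ sSup S < w (sSup S) := by
    intro w hw h
    have h' : w.symm (sSup S) < sSup S := w.symm_apply_lt.2 h
    obtain ⟨_, ⟨v, hv, rfl⟩, hlt⟩ := exists_lt_of_lt_csSup ⟨_, hmem⟩ h'
    exact absurd (le_csSup hbdd ⟨w * v, Γ.mul_mem hw hv, rfl⟩)
      (not_le.2 (w.symm_apply_lt.1 hlt))
  obtain ⟨w, hw, hne⟩ := hJ.2 (sSup S)
    ⟨le_csSup hbdd hmem, csSup_le ⟨_, hmem⟩ (by rintro _ ⟨v, hv, rfl⟩; exact hcon v hv)⟩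
  rcases lt_or_gt_of_ne hne with h | h
  · exact hlt w⁻¹ (Γ.inv_mem hw) (w.lt_symm_apply.2 h)
  · exact hlt w hw h

theorem enlarge {J : ℝ × ℝ} (hJ : FixedPointFreeInterval Γ J) {v : ℝ ≃o ℝ} (hv : v ∈ Γ) :
    FixedPointFreeInterval Γ
      (min J.1 (min (v J.1) (v.symm J.1)), max J.2 (max (v J.2) (v.symm J.2))) := by
  refine ⟨(min_le_left _ _).trans (hJ.1.trans (le_max_left _ _)), ?_⟩
  rintro x ⟨hx1, hx2⟩
  by_contra! hx
  have hvx : v x = x := hx v hv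
  have hvx' : v.symm x = x := hx v⁻¹ (Γ.inv_mem hv)
  rcases lt_or_ge x J.1 with h1 | h1
  · have h2 := v.strictMono h1
    have h3 := v.symm.strictMono h1
    rw [hvx] at h2
    rw [hvx'] at h3
    exact absurd hx1 (not_le.2 (lt_min h1 (lt_min h2 h3)))
  rcases lt_or_ge J.2 x with h1' | h1'
  · have h2 := v.strictMono h1'
    have h3 := v.symm.strictMono h1'
    rw [hvx] at h2
    rw [hvx'] at h3
    exact absurd hx2 (not_le.2 (max_lt h1' (max_lt h2 h3)))
  obtain ⟨w, hw, hne⟩ := hJ.2 x ⟨h1, h1'⟩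
  exact hne (hx w hw)

/-- Finitely many intervals without global fixed points can be displaced simultaneously. -/
theorem exists_displacing (L : List (ℝ × ℝ)) (hL : ∀ J ∈ L, FixedPointFreeInterval Γ J) :
    ∃ w ∈ Γ, ∀ J ∈ L, J.2 < w J.1 ∨ w J.2 < J.1 := by
  suffices H : ∀ n : ℕ, ∀ L : List (ℝ × ℝ), L.length = n →
      (∀ J ∈ L, FixedPointFreeInterval Γ J) →
      ∃ w ∈ Γ, ∀ J ∈ L, J.2 < w J.1 ∨ w J.2 < J.1 from H _ L rfl hL
  intro n
  induction n with
  | zero =>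
    intro L hn _
    rw [List.length_eq_zero_iff] at hn
    subst hn
    exact ⟨1, Γ.one_mem, by simp⟩
  | succ n ih =>
    intro L hn hL
    obtain ⟨I, L, rfl⟩ := List.exists_cons_of_length_eq_add_one hn
    have hI := hL I (by simp)
    obtain ⟨v, hv, hIv⟩ := hI.exists_lt_map
    have hIv' : v.symm I.2 < I.1 := v.symm_apply_lt.2 hIv
    obtain ⟨f, hf, hfL⟩ := ih (L.map fun J =>
      (min J.1 (min (v J.1) (v.symm J.1)), max J.2 (max (v J.2) (v.symm J.2))))
      (by simpa using hn) (by
        intro J hJ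
        obtain ⟨J', hJ', rfl⟩ := List.mem_map.1 hJ
        exact (hL J' (by simp [hJ'])).enlarge hv)
    have hother : ∀ J ∈ L, ∃ a b : ℝ, a ≤ J.1 ∧ a ≤ v J.1 ∧ a ≤ v.symm J.1 ∧
        J.2 ≤ b ∧ v J.2 ≤ b ∧ v.symm J.2 ≤ b ∧ (b < f a ∨ f b < a) := by
      intro J hJ
      refine ⟨_, _, ?_, ?_, ?_, ?_, ?_, ?_, hfL _ (List.mem_map_of_mem hJ)⟩ <;> simp
    rcases le_or_gt I.1 (f I.1) with h1 | h1
    · refine ⟨v * f, Γ.mul_mem hv hf, fun J hJ => ?_⟩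
      rcases List.mem_cons.1 hJ with rfl | hJ
      · exact Or.inl (hIv.trans_le (v.monotone h1))
      · obtain ⟨a, b, a1, a2, a3, b1, b2, b3, h | h⟩ := hother J hJ
        · exact Or.inl (v.symm_apply_lt.1 (b3.trans_lt (h.trans_le (f.monotone a1))))
        · exact Or.inr (v.lt_symm_apply.1 (((f.monotone b1).trans_lt h).trans_le a3))
    rcases le_or_gt (f I.2) I.2 with h2 | h2
    · refine ⟨v⁻¹ * f, Γ.mul_mem (Γ.inv_mem hv) hf, fun J hJ => ?_⟩
      rcases List.mem_cons.1 hJ with rfl | hJ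
      · exact Or.inr ((v.symm.monotone h2).trans_lt hIv')
      · obtain ⟨a, b, a1, a2, a3, b1, b2, b3, h | h⟩ := hother J hJ
        · exact Or.inl (v.lt_symm_apply.2 (b2.trans_lt (h.trans_le (f.monotone a1))))
        · exact Or.inr (v.symm_apply_lt.2 (((f.monotone b1).trans_lt h).trans_le a2))
    · refine ⟨v * f⁻¹, Γ.mul_mem hv (Γ.inv_mem hf), fun J hJ => ?_⟩
      rcases List.mem_cons.1 hJ with rfl | hJ
      · exact Or.inl (hIv.trans (v.strictMono (f.lt_symm_apply.2 h1)))
      · obtain ⟨a, b, a1, a2, a3, b1, b2, b3, h | h⟩ := hother J hJ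
        · have h' : f.symm b < a := f.symm_apply_lt.2 h
          exact Or.inr (v.lt_symm_apply.1 (((f.symm.monotone b1).trans_lt h').trans_le a3))
        · have h' : b < f.symm a := f.lt_symm_apply.2 h
          exact Or.inl (v.symm_apply_lt.1 (b3.trans_lt (h'.trans_le (f.symm.monotone a1))))

end FixedPointFreeInterval

theorem isClosed_globalFixedPoints (Γ : Subgroup (ℝ ≃o ℝ)) :
    IsClosed {x : ℝ | ∀ w ∈ Γ, w x = x} := by
  simp only [ofPred_forall]
  exact isClosed_biInter fun w _ => isClosed_eq w.continuous continuous_id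

/-- A compact set inside `[p, q]` without global fixed points can be displaced from itself. -/
theorem IsCompact.exists_displacing {Γ : Subgroup (ℝ ≃o ℝ)} {p q : ℝ} (hp : ∀ w ∈ Γ, w p = p)
    (hq : ∀ w ∈ Γ, w q = q) {K : Set ℝ} (hK : IsCompact K) (hKpq : K ⊆ Icc p q)
    (hfix : ∀ x ∈ K, ∃ w ∈ Γ, w x ≠ x) : ∃ w ∈ Γ, ∀ x ∈ K, w x ∉ K := by
  set Z : Set ℝ := {x : ℝ | ∀ w ∈ Γ, w x = x}
  have hZ : IsClosed Z := isClosed_globalFixedPoints Γ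
  have hKZ : ∀ x ∈ K, x ∉ Z := by
    intro x hx hxZ
    obtain ⟨w, hw, hne⟩ := hfix x hx
    exact hne (hxZ w hw)
  have hloc : ∀ x, ∃ (l r : ℝ) (J : ℝ × ℝ), x ∈ K → x ∈ Ioo l r ∧ l ∈ Z ∧ r ∈ Z ∧
      FixedPointFreeInterval Γ J ∧ K ∩ Ioo l r ⊆ Icc J.1 J.2 := by
    intro x
    by_cases hx : x ∈ K
    swap
    · exact ⟨0, 0, (0, 0), fun h => absurd h hx⟩
    have hbl : BddAbove (Z ∩ Iic x) := ⟨x, fun y hy => hy.2⟩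
    have hbr : BddBelow (Z ∩ Ici x) := ⟨x, fun y hy => hy.2⟩
    obtain ⟨hlZ, hlx⟩ := (hZ.inter isClosed_Iic).csSup_mem ⟨p, hp, (hKpq hx).1⟩ hbl
    obtain ⟨hrZ, hrx⟩ := (hZ.inter isClosed_Ici).csInf_mem ⟨q, hq, (hKpq hx).2⟩ hbr
    set l := sSup (Z ∩ Iic x)
    set r := sInf (Z ∩ Ici x)
    have hlx' : l < x := lt_of_le_of_ne hlx fun h => hKZ x hx (h ▸ hlZ)
    have hrx' : x < r := lt_of_le_of_ne hrx fun h => hKZ x hx (h ▸ hrZ)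
    have hC : IsCompact (K ∩ Icc l r) := hK.inter isCompact_Icc
    have hxC : x ∈ K ∩ Icc l r := ⟨hx, hlx, hrx⟩
    obtain ⟨haK, hal, -⟩ := hC.sInf_mem ⟨x, hxC⟩
    obtain ⟨hbK, -, hbr'⟩ := hC.sSup_mem ⟨x, hxC⟩
    refine ⟨l, r, (sInf (K ∩ Icc l r), sSup (K ∩ Icc l r)), fun _ =>
      ⟨⟨hlx', hrx'⟩, hlZ, hrZ, ⟨(csInf_le hC.bddBelow hxC).trans (le_csSup hC.bddAbove hxC), ?_⟩,
      fun y hy => ⟨csInf_le hC.bddBelow ⟨hy.1, Ioo_subset_Icc_self hy.2⟩,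
        le_csSup hC.bddAbove ⟨hy.1, Ioo_subset_Icc_self hy.2⟩⟩⟩⟩
    rintro y ⟨hy1, hy2⟩
    dsimp only at hy1 hy2
    by_contra! hy
    rcases le_total y x with h | h
    · have hyl : y ≤ l := le_csSup hbl ⟨hy, h⟩
      exact hKZ _ haK (by rwa [le_antisymm (hy1.trans hyl) hal])
    · have hyr : r ≤ y := csInf_le hbr ⟨hy, h⟩
      exact hKZ _ hbK (by rwa [le_antisymm hbr' (hyr.trans hy2)])
  choose l r J hJ using hloc
  obtain ⟨t, htK, hcov⟩ := hK.elim_nhds_subcover (fun x => Ioo (l x) (r x))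
    fun x hx => Ioo_mem_nhds (hJ x hx).1.1 (hJ x hx).1.2
  obtain ⟨w, hw, hwJ⟩ := FixedPointFreeInterval.exists_displacing (Γ := Γ) (t.toList.map J) (by
    intro I hI
    obtain ⟨x, hx, rfl⟩ := List.mem_map.1 hI
    exact (hJ x (htK x (Finset.mem_toList.1 hx))).2.2.2.1)
  refine ⟨w, hw, fun y hy hwy => ?_⟩
  obtain ⟨x, hxt, hyx⟩ := mem_iUnion₂.1 (hcov hy)
  obtain ⟨-, hlZ, hrZ, -, hsub⟩ := hJ x (htK x hxt)
  have hwyx : w y ∈ Ioo (l x) (r x) := by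
    have h1 := w.strictMono hyx.1
    have h2 := w.strictMono hyx.2
    rw [hlZ w hw] at h1
    rw [hrZ w hw] at h2
    exact ⟨h1, h2⟩
  have hyJ := hsub ⟨hy, hyx⟩
  have hwyJ := hsub ⟨hwy, hwyx⟩
  rcases hwJ (J x) (List.mem_map_of_mem (Finset.mem_toList.2 hxt)) with h | h
  · exact absurd (hwyJ.2) (not_le.2 (h.trans_le (w.monotone hyJ.1)))
  · exact absurd (hwyJ.1) (not_le.2 ((w.monotone hyJ.2).trans_lt h))

namespace CircleDeg1Lift

/-- Two strictly monotone lifts of the same circle map that agree at a point are equal. -/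
theorem eq_of_coe_eq {A B : CircleDeg1Lift} (hA : StrictMono A) (hB : StrictMono B) {x₀ : ℝ}
    (h₀ : A x₀ = B x₀) {y : ℝ} (h : ((A y : ℝ) : S1) = ((B y : ℝ) : S1)) : A y = B y := by
  have hmem : ∀ C : CircleDeg1Lift, StrictMono C →
      C (y - ⌊y - x₀⌋) ∈ Ico (C x₀) (C x₀ + 1) := by
    intro C hC
    have h1 := Int.floor_le (y - x₀)
    have h2 := Int.lt_floor_add_one (y - x₀)
    refine ⟨C.monotone (by linarith), ?_⟩
    rw [← C.map_add_one]
    exact hC (by linarith)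
  have hAm := hmem A hA
  have hBm := hmem B hB
  rw [← h₀] at hBm
  have hsub : ∀ C : CircleDeg1Lift,
      ((C (y - ⌊y - x₀⌋) : ℝ) : S1) = (C y : S1) - ((⌊y - x₀⌋ : ℝ) : S1) := by
    intro C
    rw [C.map_sub_int, AddCircle.coe_sub]
  have heq := (AddCircle.coe_eq_coe_iff_of_mem_Ico hAm hBm).1 (by rw [hsub, hsub, h])
  rw [A.map_sub_int, B.map_sub_int] at heq
  linarith

/-- If `f ∘ g ≤ g ∘ f` on a nonempty invariant set, then the translation number is additive on
`f` and `g`. -/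
theorem translationNumber_mul_of_le (f g : CircleDeg1Lift) {C : Set ℝ} (hC : C.Nonempty)
    (hf : ∀ y ∈ C, f y ∈ C) (hg : ∀ y ∈ C, g y ∈ C) (hle : ∀ y ∈ C, f (g y) ≤ g (f y)) :
    translationNumber (f * g) = translationNumber f + translationNumber g := by
  have hgn : ∀ n : ℕ, ∀ y ∈ C, f (g^[n] y) ≤ g^[n] (f y) := by
    intro n
    induction n with
    | zero => intro y _; exact le_rfl
    | succ n ih =>
      intro y hy
      rw [iterate_succ_apply, iterate_succ_apply]
      exact (ih _ (hg y hy)).trans (g.monotone.iterate n (hle y hy))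
  have hfn : ∀ n : ℕ, ∀ y ∈ C, f^[n] (g y) ≤ g (f^[n] y) := by
    intro n
    induction n with
    | zero => intro y _; exact le_rfl
    | succ n ih =>
      intro y hy
      rw [iterate_succ_apply, iterate_succ_apply]
      exact (f.monotone.iterate n (hle y hy)).trans (ih _ (hf y hy))
  have hlow : ∀ n : ℕ, ∀ y ∈ C, f^[n] (g^[n] y) ≤ (f * g)^[n] y := by
    intro n
    induction n with
    | zero => intro y _; exact le_rfl
    | succ n ih =>
      intro y hy
      rw [iterate_succ_apply, iterate_succ_apply, iterate_succ_apply]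
      exact (f.monotone.iterate n (hgn n _ (hg y hy))).trans (ih _ (hf _ (hg y hy)))
  have hup : ∀ n : ℕ, ∀ y ∈ C, (f * g)^[n] y ≤ g^[n] (f^[n] y) := by
    intro n
    induction n with
    | zero => intro y _; exact le_rfl
    | succ n ih =>
      intro y hy
      refine (ih _ (hf _ (hg y hy))).trans ?_
      rw [iterate_succ_apply g]
      refine g.monotone.iterate n ?_
      simpa only [iterate_succ_apply] using hfn (n + 1) y hy
  obtain ⟨x, hx⟩ := hC
  have hlim : ∀ h : CircleDeg1Lift, ∀ z c : ℝ,
      Tendsto (fun n : ℕ => (h^[n] z + c) / n) atTop (𝓝 (translationNumber h)) := by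
    intro h z c
    have h1 := h.tendsto_translationNumber z
    have h2 : Tendsto (fun n : ℕ => (z + c) / (n : ℝ)) atTop (𝓝 0) :=
      tendsto_const_div_atTop_nhds_zero_nat _
    refine ((add_zero (translationNumber h)) ▸ h1.add h2).congr fun n => ?_
    rw [coe_pow]
    ring
  have hbound : ∀ a b : CircleDeg1Lift, ∀ n : ℕ,
      a^[n] 0 + (b^[n] x + -1) ≤ a^[n] (b^[n] x) ∧
      a^[n] (b^[n] x) ≤ a^[n] 0 + (b^[n] x + 1) := by
    intro a b n
    have h1 := (a ^ n).le_map_of_map_zero (b^[n] x)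
    have h2 := (a ^ n).map_le_of_map_zero (b^[n] x)
    have h3 := Int.sub_one_lt_floor (b^[n] x)
    have h4 := Int.ceil_lt_add_one (b^[n] x)
    rw [coe_pow] at h1 h2
    constructor <;> linarith
  have hfg := hlim (f * g) x 0
  refine le_antisymm ?_ ?_
  · refine le_of_tendsto_of_tendsto' hfg ((hlim f x 1).add (hlim g 0 0)) fun n => ?_
    rw [← add_div]
    exact div_le_div_of_nonneg_right (by linarith [hup n x hx, (hbound g f n).2])
      (Nat.cast_nonneg n)
  · refine le_of_tendsto_of_tendsto' ((hlim f 0 0).add (hlim g x (-1))) hfg fun n => ?_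
    rw [← add_div]
    exact div_le_div_of_nonneg_right (by linarith [hlow n x hx, (hbound f g n).1])
      (Nat.cast_nonneg n)

end CircleDeg1Lift

/-- The bundled form of a lift. -/
def IsLiftOf.toCircleDeg1Lift {f : Equiv.Perm S1} {F : ℝ → ℝ} (hF : IsLiftOf f F) :
    CircleDeg1Lift :=
  ⟨⟨F, hF.1.monotone⟩, hF.2.2.1⟩

theorem IsLiftOf.coe_toCircleDeg1Lift {f : Equiv.Perm S1} {F : ℝ → ℝ} (hF : IsLiftOf f F) :
    ⇑hF.toCircleDeg1Lift = F := rfl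

theorem HasRotLim.eq_translationNumber {f : Equiv.Perm S1} {F : ℝ → ℝ} (hF : IsLiftOf f F)
    {ρ : ℝ} (h : HasRotLim F ρ) : ρ = hF.toCircleDeg1Lift.translationNumber := by
  refine tendsto_nhds_unique h ?_
  simpa only [CircleDeg1Lift.coe_pow, hF.coe_toCircleDeg1Lift] using
    hF.toCircleDeg1Lift.tendsto_translation_number₀

theorem exists_int_of_coe_eq {x y : ℝ} (h : (x : S1) = (y : S1)) : ∃ m : ℤ, x = y + m := by
  rw [← sub_eq_zero, ← AddCircle.coe_sub, AddCircle.coe_eq_zero_iff] at h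
  obtain ⟨m, hm⟩ := h
  exact ⟨m, by simp at hm; linarith⟩

theorem coe_int_eq_zero (m : ℤ) : ((m : ℝ) : S1) = 0 :=
  (AddCircle.coe_eq_zero_iff 1).2 ⟨m, by simp⟩

theorem exists_mem_Ico_coe_eq (p : ℝ) (x : S1) : ∃ y ∈ Ico p (p + 1), (y : S1) = x := by
  have h : x ∈ ((↑) : ℝ → S1) '' Ico p (p + 1) := by
    rw [AddCircle.coe_image_Ico_eq]
    trivial
  exact h

theorem IsPosHomeo.continuous {f : Equiv.Perm S1} (hf : IsPosHomeo f) : Continuous f := by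
  obtain ⟨F, -, hF, -, hfF⟩ := hf
  refine isQuotientMap_quotient_mk'.continuous_iff.2 ?_
  exact ((AddCircle.continuous_mk' 1).comp hF).congr fun x => (hfF x).symm

theorem IsPosHomeo.isClosed_fixedPoints {f : Equiv.Perm S1} (hf : IsPosHomeo f) :
    IsClosed {x | f x = x} :=
  isClosed_eq hf.continuous continuous_id

/-- The lifts of `f` that fix the real number `p`. -/
structure IsLiftFixing (f : Equiv.Perm S1) (p : ℝ) (Φ : ℝ ≃o ℝ) : Prop where
  map_base : Φ p = p
  map_add_one : ∀ x, Φ (x + 1) = Φ x + 1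
  coe_eq : ∀ x : ℝ, f (x : S1) = (Φ x : S1)

theorem IsPosHomeo.exists_isLiftFixing {f : Equiv.Perm S1} (hf : IsPosHomeo f) {p : ℝ}
    (hp : f (p : S1) = p) : ∃ Φ, IsLiftFixing f p Φ := by
  obtain ⟨F, hF⟩ := hf
  obtain ⟨m, hm⟩ := exists_int_of_coe_eq ((hF.2.2.2 p).symm.trans hp)
  have hsurj : Surjective F :=
    hF.toCircleDeg1Lift.continuous_iff_surjective.1 hF.2.1
  refine ⟨StrictMono.orderIsoOfSurjective (fun x => F x - m)
    (fun x y h => sub_lt_sub_right (hF.1 h) _) fun y => ?_, ?_, fun x => ?_, fun x => ?_⟩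
  · obtain ⟨x, hx⟩ := hsurj (y + m)
    exact ⟨x, by simp [hx]⟩
  · change F p - m = p
    linarith
  · change F (x + 1) - m = F x - m + 1
    rw [hF.2.2.1]
    ring
  · change f (x : S1) = ((F x - m : ℝ) : S1)
    rw [hF.2.2.2, AddCircle.coe_sub, coe_int_eq_zero, sub_zero]

namespace IsLiftFixing

variable {f g : Equiv.Perm S1} {p : ℝ} {Φ Ψ : ℝ ≃o ℝ}

theorem map_eq_self (h : IsLiftFixing f p Φ) {x : ℝ} (hx : f (x : S1) = x) : Φ x = x :=
  CircleDeg1Lift.eq_of_coe_eq (A := ⟨⟨Φ, Φ.monotone⟩, h.map_add_one⟩) (B := 1) (x₀ := p)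
    Φ.strictMono strictMono_id h.map_base ((h.coe_eq x).symm.trans hx)

theorem map_base_add_one (h : IsLiftFixing f p Φ) : Φ (p + 1) = p + 1 := by
  rw [h.map_add_one, h.map_base]

theorem one : IsLiftFixing 1 p 1 := ⟨rfl, fun _ => rfl, fun _ => rfl⟩

theorem mul (h : IsLiftFixing f p Φ) (h' : IsLiftFixing g p Ψ) :
    IsLiftFixing (f * g) p (Φ * Ψ) where
  map_base := by rw [RelIso.mul_apply, h'.map_base, h.map_base]
  map_add_one x := by simp only [RelIso.mul_apply, h'.map_add_one, h.map_add_one]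
  coe_eq x := by rw [Equiv.Perm.mul_apply, h'.coe_eq, h.coe_eq, RelIso.mul_apply]

theorem inv (h : IsLiftFixing f p Φ) : IsLiftFixing f⁻¹ p Φ⁻¹ where
  map_base := Φ.symm_apply_eq.2 h.map_base.symm
  map_add_one x := Φ.symm_apply_eq.2 <| by
    rw [h.map_add_one]
    exact congrArg (· + 1) (Φ.apply_symm_apply x).symm
  coe_eq x := by
    rw [Equiv.Perm.inv_eq_iff_eq, h.coe_eq]
    exact congrArg _ (Φ.apply_symm_apply x).symm

theorem coe_pow_eq (h : IsLiftFixing f p Φ) (n : ℕ) (x : ℝ) :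
    (f ^ n) (x : S1) = (Φ^[n] x : S1) := by
  induction n generalizing x with
  | zero => rfl
  | succ n ih => rw [pow_succ, Equiv.Perm.mul_apply, h.coe_eq, ih, iterate_succ_apply]

end IsLiftFixing

/-- The group of lifts fixing `p` of elements of `G`. -/
def liftsFixing (G : Subgroup (Equiv.Perm S1)) (p : ℝ) : Subgroup (ℝ ≃o ℝ) where
  carrier := {Φ | ∃ g ∈ G, IsLiftFixing g p Φ}
  one_mem' := ⟨1, G.one_mem, IsLiftFixing.one⟩
  mul_mem' := by
    rintro Φ Ψ ⟨f, hf, hΦ⟩ ⟨g, hg, hΨ⟩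
    exact ⟨f * g, G.mul_mem hf hg, hΦ.mul hΨ⟩
  inv_mem' := by
    rintro Φ ⟨f, hf, hΦ⟩
    exact ⟨f⁻¹, G.inv_mem hf, hΦ.inv⟩

/-- Large powers of a circle homeomorphism with a fixed point move the complement of a
neighbourhood of the fixed point set into that neighbourhood. -/
theorem IsPosHomeo.exists_forall_pow_mem {f : Equiv.Perm S1} (hf : IsPosHomeo f)
    (hfix : ∃ x, f x = x) {W : Set S1} (hW : IsOpen W) (hfW : ∀ x, f x = x → x ∈ W) :
    ∃ N : ℕ, ∀ n ≥ N, ∀ x ∉ W, (f ^ n) x ∈ W := by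
  obtain ⟨x₀, hx₀⟩ := hfix
  obtain ⟨p, -, rfl⟩ := exists_mem_Ico_coe_eq 0 x₀
  obtain ⟨Φ, hΦ⟩ := hf.exists_isLiftFixing hx₀
  obtain ⟨N, hN⟩ := Φ.exists_forall_iterate_mem hΦ.map_base hΦ.map_base_add_one
    (hW.preimage (AddCircle.continuous_mk' 1))
    (fun x _ hx => hfW _ ((hΦ.coe_eq x).trans (congrArg _ hx)))
  refine ⟨N, fun n hn x hx => ?_⟩
  obtain ⟨y, hy, rfl⟩ := exists_mem_Ico_coe_eq p x
  rw [hΦ.coe_pow_eq]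
  exact hN n hn y ⟨Ico_subset_Icc_self hy, hx⟩

theorem zpow_mem_of_forall_pow_mem {f : Equiv.Perm S1} {W : Set S1} {N : ℕ}
    (h : ∀ n ≥ N, ∀ x ∉ W, (f ^ n) x ∈ W) {k : ℤ} (hk : k ≠ 0) {x : S1} (hx : x ∉ W) :
    ((f ^ N) ^ k) x ∈ W := by
  have hge : ∀ n : ℕ, n ≠ 0 → N * n ≥ N := fun n hn =>
    Nat.le_mul_of_pos_right N (Nat.pos_of_ne_zero hn)
  obtain ⟨n, rfl | rfl⟩ := k.eq_nat_or_neg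
  · rw [zpow_natCast, ← pow_mul]
    exact h _ (hge n (by simpa using hk)) x hx
  · by_contra hcon
    have := h _ (hge n (by simpa using hk)) _ hcon
    rw [zpow_neg, zpow_natCast, ← pow_mul, ← Equiv.Perm.mul_apply, mul_inv_cancel,
      Equiv.Perm.one_apply] at this
    exact hx this

section NoFreeSubgroup

variable {G : Subgroup (Equiv.Perm S1)}

theorem exists_common_fixedPoint_of_not_hasFreeSubgroup (hpos : ∀ g ∈ G, IsPosHomeo g)
    (hfree : ¬ HasFreeSubgroup G) {f g : Equiv.Perm S1} (hf : f ∈ G) (hg : g ∈ G)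
    (hff : ∃ x, f x = x) (hgf : ∃ x, g x = x) : ∃ x, f x = x ∧ g x = x := by
  by_contra! hcon
  apply hfree
  obtain ⟨U, V, hU, hV, hfU, hgV, hUV⟩ := normal_separation
    (hpos f hf).isClosed_fixedPoints (hpos g hg).isClosed_fixedPoints
    (disjoint_left.2 fun x hx => hcon x hx)
  obtain ⟨N, hN⟩ := (hpos f hf).exists_forall_pow_mem hff hU fun x hx => hfU hx
  obtain ⟨M, hM⟩ := (hpos g hg).exists_forall_pow_mem hgf hV fun x hx => hgV hx
  refine ⟨FreeGroup.lift ![f ^ N, g ^ M],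
    FreeGroup.injective_lift_of_zpow_ping_pong _ ![U, V] ?_ ?_ ?_, fun w => ?_⟩
  · intro i
    fin_cases i
    · exact hff.imp fun x hx => hfU hx
    · exact hgf.imp fun x hx => hgV hx
  · intro i j hij
    fin_cases i <;> fin_cases j
    · exact absurd rfl hij
    · exact hUV
    · exact hUV.symm
    · exact absurd rfl hij
  · intro i j hij n hn x hx
    fin_cases i <;> fin_cases j
    · exact absurd rfl hij
    · exact zpow_mem_of_forall_pow_mem hN hn (disjoint_right.1 hUV hx)
    · exact zpow_mem_of_forall_pow_mem hM hn (disjoint_left.1 hUV hx)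
    · exact absurd rfl hij
  · have hrange : (FreeGroup.lift ![f ^ N, g ^ M]).range ≤ G := by
      rw [FreeGroup.range_lift_eq_closure, Subgroup.closure_le]
      rintro _ ⟨i, rfl⟩
      fin_cases i
      · exact G.pow_mem hf _
      · exact G.pow_mem hg _
    exact hrange ⟨w, rfl⟩

theorem exists_common_fixedPoint_subgroup (hpos : ∀ g ∈ G, IsPosHomeo g)
    (hfree : ¬ HasFreeSubgroup G) {G₁ : Subgroup (Equiv.Perm S1)} (hG₁ : G₁ ≤ G)
    {h : Equiv.Perm S1} (hh : h ∈ G) (hfix : ∃ x, h x = x) (hfix₁ : ∃ x, ∀ g ∈ G₁, g x = x) :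
    ∃ x, h x = x ∧ ∀ g ∈ G₁, g x = x := by
  by_contra! hcon
  obtain ⟨x₀, hx₀⟩ := hfix₁
  obtain ⟨p, -, rfl⟩ := exists_mem_Ico_coe_eq 0 x₀
  have hK : IsCompact (Icc p (p + 1) ∩ ((↑) : ℝ → S1) ⁻¹' {x | h x = x}) :=
    isCompact_Icc.inter_right ((hpos h hh).isClosed_fixedPoints.preimage
      (AddCircle.continuous_mk' 1))
  obtain ⟨w, ⟨g, hg, hgw⟩, hwK⟩ := hK.exists_displacing (Γ := liftsFixing G₁ p) (p := p)
    (q := p + 1) (fun w ⟨_, _, hw⟩ => hw.map_base) (fun w ⟨_, _, hw⟩ => hw.map_base_add_one)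
    inter_subset_left (by
      rintro x ⟨-, hx⟩
      obtain ⟨g, hg, hgx⟩ := hcon x hx
      obtain ⟨Φ, hΦ⟩ := (hpos g (hG₁ hg)).exists_isLiftFixing (hx₀ g hg)
      exact ⟨Φ, ⟨g, hg, hΦ⟩, fun hΦx => hgx ((hΦ.coe_eq x).trans (congrArg _ hΦx))⟩)
  obtain ⟨x, hx, hx'⟩ := exists_common_fixedPoint_of_not_hasFreeSubgroup hpos hfree hh
    (G.mul_mem (G.mul_mem (hG₁ hg) hh) (G.inv_mem (hG₁ hg))) hfix (by
      obtain ⟨y, hy⟩ := hfix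
      exact ⟨g y, by simp [hy]⟩)
  obtain ⟨y, hy, hyx⟩ := exists_mem_Ico_coe_eq p (g⁻¹ x)
  have hgy : g (y : S1) = x := by
    rw [hyx, ← Equiv.Perm.mul_apply, mul_inv_cancel, Equiv.Perm.one_apply]
  refine hwK y ⟨Ico_subset_Icc_self hy, ?_⟩ ⟨⟨?_, ?_⟩, ?_⟩
  · rw [mem_preimage, hyx, mem_ofPred_eq, Equiv.Perm.eq_inv_iff_eq]
    exact hx'
  · exact hgw.map_base ▸ w.monotone hy.1
  · exact hgw.map_base_add_one ▸ w.monotone hy.2.le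
  · rw [mem_preimage, ← hgw.coe_eq, hgy]
    exact hx

theorem exists_common_fixedPoint_finset (hpos : ∀ g ∈ G, IsPosHomeo g)
    (hfree : ¬ HasFreeSubgroup G) (S : Finset (Equiv.Perm S1))
    (hS : ∀ g ∈ S, g ∈ G ∧ ∃ x, g x = x) : ∃ x, ∀ g ∈ S, g x = x := by
  classical
  induction S using Finset.induction_on with
  | empty => exact ⟨0, by simp⟩
  | insert h S _ ih =>
    obtain ⟨p, hp⟩ := ih fun g hg => hS g (Finset.mem_insert_of_mem hg)
    have hle : Subgroup.closure (S : Set (Equiv.Perm S1)) ≤ MulAction.stabilizer _ p :=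
      (Subgroup.closure_le _).2 fun g hg => hp g hg
    obtain ⟨hh, hfix⟩ := hS h (Finset.mem_insert_self h S)
    obtain ⟨x, hx, hx'⟩ := exists_common_fixedPoint_subgroup hpos hfree
      ((Subgroup.closure_le G).2 fun g hg => (hS g (Finset.mem_insert_of_mem hg)).1) hh hfix
      ⟨p, fun g hg => hle hg⟩
    refine ⟨x, fun g hg => ?_⟩
    rcases Finset.mem_insert.1 hg with rfl | hg
    · exact hx
    · exact hx' g (Subgroup.subset_closure hg)

/-- An element with a fixed point fixes a whole orbit pointwise. -/
theorem exists_orbit_fixed (hpos : ∀ g ∈ G, IsPosHomeo g) (hfree : ¬ HasFreeSubgroup G)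
    {c : Equiv.Perm S1} (hc : c ∈ G) (hfix : ∃ x, c x = x) : ∃ x, ∀ w ∈ G, c (w x) = w x := by
  classical
  have hconj : ∀ (w : G) (x : S1), c ((w : Equiv.Perm S1) x) = (w : Equiv.Perm S1) x ↔
      ((w : Equiv.Perm S1)⁻¹ * c * w) x = x := by
    intro w x
    rw [Equiv.Perm.mul_apply, Equiv.Perm.mul_apply, Equiv.Perm.inv_eq_iff_eq]
  obtain ⟨x, -, hx⟩ := isCompact_univ.inter_iInter_nonempty
    (fun w : G => {x : S1 | c ((w : Equiv.Perm S1) x) = (w : Equiv.Perm S1) x})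
    (fun w => isClosed_eq ((hpos c hc).continuous.comp (hpos w w.2).continuous)
      (hpos w w.2).continuous) (by
    intro u
    obtain ⟨x, hx⟩ := exists_common_fixedPoint_finset hpos hfree
      (u.image fun w : G => (w : Equiv.Perm S1)⁻¹ * c * w) (by
        intro g hg
        obtain ⟨w, -, rfl⟩ := Finset.mem_image.1 hg
        refine ⟨G.mul_mem (G.mul_mem (G.inv_mem w.2) hc) w.2, ?_⟩
        obtain ⟨y, hy⟩ := hfix
        exact ⟨(w : Equiv.Perm S1)⁻¹ y, by simp [hy]⟩)
    refine ⟨x, trivial, mem_iInter₂.2 fun w hw => (hconj w x).2 ?_⟩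
    exact hx _ (Finset.mem_image_of_mem _ hw))
  exact ⟨x, fun w hw => mem_iInter.1 hx ⟨w, hw⟩⟩

theorem translationNumber_mul_of_not_hasFreeSubgroup (hpos : ∀ g ∈ G, IsPosHomeo g)
    (hfree : ¬ HasFreeSubgroup G) {f g : Equiv.Perm S1} (hf : f ∈ G) (hg : g ∈ G) {F H : ℝ → ℝ}
    (hF : IsLiftOf f F) (hH : IsLiftOf g H) :
    (hF.toCircleDeg1Lift * hH.toCircleDeg1Lift).translationNumber =
      hF.toCircleDeg1Lift.translationNumber + hH.toCircleDeg1Lift.translationNumber := by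
  set A := hF.toCircleDeg1Lift
  set B := hH.toCircleDeg1Lift
  have hAB : Continuous fun x => A (B x) := hF.2.1.comp hH.2.1
  have hBA : Continuous fun x => B (A x) := hH.2.1.comp hF.2.1
  by_cases hle : ∀ x, A (B x) ≤ B (A x)
  · exact A.translationNumber_mul_of_le B univ_nonempty (fun _ _ => trivial) (fun _ _ => trivial)
      fun x _ => hle x
  by_cases hge : ∀ x, B (A x) ≤ A (B x)
  · have hconj : SemiconjBy A (B * A) (A * B) := (mul_assoc A B A).symm
    rw [← CircleDeg1Lift.translationNumber_eq_of_semiconjBy hconj,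
      B.translationNumber_mul_of_le A univ_nonempty (fun _ _ => trivial) (fun _ _ => trivial)
        fun x _ => hge x, add_comm]
  push Not at hle hge
  obtain ⟨a, ha⟩ := hle
  obtain ⟨b, hb⟩ := hge
  obtain ⟨x₀, hx₀⟩ := intermediate_value_univ₂ hBA hAB ha.le hb.le
  have hcoeAB : ∀ x : ℝ, (f * g) (x : S1) = (A (B x) : S1) := fun x => by
    rw [Equiv.Perm.mul_apply, hH.2.2.2, hF.2.2.2]
    rfl
  have hcoeBA : ∀ x : ℝ, (g * f) (x : S1) = (B (A x) : S1) := fun x => by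
    rw [Equiv.Perm.mul_apply, hF.2.2.2, hH.2.2.2]
    rfl
  have hcomm : ∀ x : S1, ((g * f)⁻¹ * (f * g)) x = x ↔ (f * g) x = (g * f) x := fun x => by
    rw [Equiv.Perm.mul_apply, Equiv.Perm.inv_eq_iff_eq]
  obtain ⟨x, hx⟩ := exists_orbit_fixed hpos hfree
    (G.mul_mem (G.inv_mem (G.mul_mem hg hf)) (G.mul_mem hf hg))
    ⟨x₀, (hcomm x₀).2 (by rw [hcoeAB, hcoeBA, hx₀])⟩
  refine A.translationNumber_mul_of_le B (C := {y : ℝ | ∃ w ∈ G, w x = y}) ?_ ?_ ?_ ?_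
  · obtain ⟨y, -, hy⟩ := exists_mem_Ico_coe_eq 0 x
    exact ⟨y, 1, G.one_mem, hy.symm⟩
  · rintro y ⟨w, hw, hwy⟩
    exact ⟨f * w, G.mul_mem hf hw, by rw [Equiv.Perm.mul_apply, hwy, hF.2.2.2]; rfl⟩
  · rintro y ⟨w, hw, hwy⟩
    exact ⟨g * w, G.mul_mem hg hw, by rw [Equiv.Perm.mul_apply, hwy, hH.2.2.2]; rfl⟩
  · rintro y ⟨w, hw, hwy⟩
    have hy := (hcomm _).1 (hx w hw)
    rw [hwy, hcoeAB, hcoeBA] at hy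
    exact (CircleDeg1Lift.eq_of_coe_eq (A := A * B) (B := B * A) (hF.1.comp hH.1)
      (hH.1.comp hF.1) hx₀.symm hy).le

end NoFreeSubgroup

theorem IsLiftOf.exists_translationNumber_eq_mul {f g : Equiv.Perm S1} {F H K : ℝ → ℝ}
    (hF : IsLiftOf f F) (hH : IsLiftOf g H) (hK : IsLiftOf (f * g) K) :
    ∃ m : ℤ, hK.toCircleDeg1Lift.translationNumber =
      (hF.toCircleDeg1Lift * hH.toCircleDeg1Lift).translationNumber + m := by
  set P := hF.toCircleDeg1Lift * hH.toCircleDeg1Lift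
  have hcoe : ∀ x : ℝ, (K x : S1) = (P x : S1) := fun x => by
    rw [← hK.2.2.2, Equiv.Perm.mul_apply, hH.2.2.2, hF.2.2.2]
    rfl
  obtain ⟨m, hm⟩ := exists_int_of_coe_eq (hcoe 0)
  set T : CircleDeg1Lift := ↑(CircleDeg1Lift.translate (Multiplicative.ofAdd (m : ℝ)))
  have hT : ∀ x, T x = m + x := CircleDeg1Lift.translate_apply _
  have hcomm : Commute T P := by
    ext x
    rw [CircleDeg1Lift.mul_apply T, CircleDeg1Lift.mul_apply P, hT, hT, P.map_int_add]
  have hKT : hK.toCircleDeg1Lift = T * P := by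
    ext x
    have hmono : StrictMono (T * P) := fun x y hxy => by
      rw [CircleDeg1Lift.mul_apply T, CircleDeg1Lift.mul_apply T, hT, hT]
      exact (add_lt_add_iff_left _).2 (hF.1 (hH.1 hxy))
    refine CircleDeg1Lift.eq_of_coe_eq hK.1 hmono (x₀ := 0) ?_ ?_
    · rw [CircleDeg1Lift.mul_apply, hT, add_comm]
      exact hm
    · rw [CircleDeg1Lift.mul_apply, hT, AddCircle.coe_add, coe_int_eq_zero, zero_add]
      exact hcoe x
  refine ⟨m, ?_⟩
  rw [hKT, CircleDeg1Lift.translationNumber_mul_of_commute hcomm,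
    CircleDeg1Lift.translationNumber_translate, add_comm]

end Helpers

/-- For a subgroup G of Homeo₊(S¹) with no non-abelian free subgroup, the rotation
number map rot : G → ℝ/ℤ is a group homomorphism: for f, g in G and lifts F, H, K of
f, g, f*g with translation numbers ρ₁, ρ₂, ρ₃, one has ρ₃ = ρ₁ + ρ₂ modulo ℤ. -/
theorem stmt7 (G : Subgroup (Equiv.Perm S1)) (hpos : ∀ g ∈ G, IsPosHomeo g)
    (hfree : ¬ HasFreeSubgroup G) :
    ∀ f ∈ G, ∀ g ∈ G, ∀ F H K : ℝ → ℝ, ∀ ρ₁ ρ₂ ρ₃ : ℝ,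
      IsLiftOf f F → IsLiftOf g H → IsLiftOf (f * g) K →
      HasRotLim F ρ₁ → HasRotLim H ρ₂ → HasRotLim K ρ₃ →
      ∃ m : ℤ, ρ₃ = ρ₁ + ρ₂ + m := by
  intro f hf g hg F H K ρ₁ ρ₂ ρ₃ hF hH hK h₁ h₂ h₃
  obtain ⟨m, hm⟩ := hF.exists_translationNumber_eq_mul hH hK
  refine ⟨m, ?_⟩
  rw [h₁.eq_translationNumber hF, h₂.eq_translationNumber hH, h₃.eq_translationNumber hK, hm,
    translationNumber_mul_of_not_hasFreeSubgroup hpos hfree hf hg hF hH]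
end
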